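/- arXiv:2403.04844 — 3 statements merged into one kernel-verified Lean document; each statement's English description precedes it below -/
import Mathlib

section
/- Let ρ₀ be an n×n density matrix and let H_A, H_B, G, O be Hermitian n×n complex matrices. Define A(t₁,t₂) = i·Tr[exp(-i·t₂·H_B)·ρ₀·exp(i·t₂·H_B)·[G, exp(i·t₁·H_A)·O·exp(-i·t₁·H_A)]], and set K = max(‖H_B‖, ‖[H_A,O]‖) and Q = max(‖[G,O]‖, ‖G‖). Then for all t_A, t_B ≥ 0, |A(t_A, t_B) − A(0,0)| ≤ 2·K·Q·(t_A + t_B). -/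
open scoped Matrix.Norms.L2Operator ComplexOrder
open Matrix NormedSpace

section CStarAlgebra

variable {E : Type*} [CStarAlgebra E]

/-- The time evolution operator of a self-adjoint Hamiltonian is unitary. -/
theorem exp_I_mul_ofReal_smul_mem_unitary {h : E} (hh : IsSelfAdjoint h) (t : ℝ) :
    exp ((Complex.I * (t : ℂ)) • h) ∈ unitary E := by
  let : NormedAlgebra ℚ E := .restrictScalars ℚ ℂ E
  refine exp_mem_unitary_of_mem_skewAdjoint (hh.smul_mem_skewAdjoint ?_)
  simp [skewAdjoint.mem_iff]

theorem exp_neg_I_mul_ofReal_smul_mem_unitary {h : E} (hh : IsSelfAdjoint h) (t : ℝ) :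
    exp ((-Complex.I * (t : ℂ)) • h) ∈ unitary E := by
  simpa using exp_I_mul_ofReal_smul_mem_unitary hh (-t)

/-- Heisenberg evolution moves an observable at speed at most the norm of its commutator with
the Hamiltonian. -/
theorem norm_exp_conj_sub_le {h : E} (hh : IsSelfAdjoint h) (x : E) {t : ℝ} (ht : 0 ≤ t) :
    ‖exp ((Complex.I * (t : ℂ)) • h) * x * exp ((-Complex.I * (t : ℂ)) • h) - x‖ ≤
      ‖h * x - x * h‖ * t := by
  have hderiv (s : ℝ) : HasDerivAt
      (fun s : ℝ ↦ exp ((Complex.I * (s : ℂ)) • h) * x * exp ((-Complex.I * (s : ℂ)) • h))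
      (exp ((Complex.I * (s : ℂ)) • h) * (Complex.I • (h * x - x * h)) *
        exp ((-Complex.I * (s : ℂ)) • h)) s := by
    have hsmul (z : ℂ) (s : ℝ) : (z * (s : ℂ)) • h = s • (z • h) := by
      rw [mul_comm, mul_smul, Complex.coe_smul]
    simp only [hsmul]
    convert! ((hasDerivAt_exp_smul_const (Complex.I • h) s).mul_const x).mul
      (hasDerivAt_exp_smul_const' (-Complex.I • h) s) using 1
    simp only [smul_sub, mul_sub, sub_mul, neg_smul, mul_neg, neg_mul, mul_smul_comm,
      smul_mul_assoc, mul_assoc]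
    abel
  have hbound := norm_image_sub_le_of_norm_deriv_le_segment' (C := ‖h * x - x * h‖)
    (fun s _ ↦ (hderiv s).hasDerivWithinAt) (fun s _ ↦ ?_) t (Set.right_mem_Icc.2 ht)
  · simpa using hbound
  · rw [CStarRing.norm_mul_mem_unitary _ (exp_neg_I_mul_ofReal_smul_mem_unitary hh s),
      CStarRing.norm_mem_unitary_mul _ (exp_I_mul_ofReal_smul_mem_unitary hh s), norm_smul]
    simp

end CStarAlgebra

theorem norm_commutator_le {R : Type*} [NormedRing R] (x y : R) :
    ‖x * y - y * x‖ ≤ 2 * ‖x‖ * ‖y‖ := by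
  linarith [norm_sub_le (x * y) (y * x), norm_mul_le x y, norm_mul_le y x, mul_comm ‖x‖ ‖y‖]

namespace Matrix

variable {m : Type*} [Fintype m] [DecidableEq m]

theorem norm_apply_le_l2_opNorm (X : Matrix m m ℂ) (i j : m) : ‖X i j‖ ≤ ‖X‖ := by
  have h₁ := X.l2_opNorm_mulVec (EuclideanSpace.single j 1)
  have h₂ := PiLp.norm_apply_le
    ((EuclideanSpace.equiv m ℂ).symm (X *ᵥ (EuclideanSpace.single j (1 : ℂ)))) i
  simpa using h₂.trans h₁

/-- Trace duality between a positive semidefinite matrix and the operator norm. -/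
theorem PosSemidef.norm_trace_mul_le {ρ : Matrix m m ℂ} (hρ : ρ.PosSemidef) (X : Matrix m m ℂ) :
    ‖(ρ * X).trace‖ ≤ ‖ρ.trace‖ * ‖X‖ := by
  set U := hρ.isHermitian.eigenvectorUnitary
  set d := hρ.isHermitian.eigenvalues
  have hd (i : m) : 0 ≤ d i := hρ.eigenvalues_nonneg i
  have htrace : (ρ * X).trace = ∑ i, (d i : ℂ) * (star (U : Matrix m m ℂ) * X * U) i i := by
    conv_lhs => rw [hρ.isHermitian.spectral_theorem, Unitary.conjStarAlgAut_apply]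
    rw [mul_assoc, mul_assoc, trace_mul_comm, mul_assoc]
    simp only [trace, diag_apply, diagonal_mul, Function.comp_apply]
    rfl
  have hρtrace : ‖ρ.trace‖ = ∑ i, d i := by
    rw [hρ.isHermitian.trace_eq_sum_eigenvalues]
    simp only [← RCLike.ofReal_sum, RCLike.norm_ofReal]
    exact abs_of_nonneg (Finset.sum_nonneg fun i _ ↦ hd i)
  rw [htrace, hρtrace, Finset.sum_mul]
  refine (norm_sum_le _ _).trans (Finset.sum_le_sum fun i _ ↦ ?_)
  rw [norm_mul, Complex.norm_real, Real.norm_of_nonneg (hd i)]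
  refine mul_le_mul_of_nonneg_left ((norm_apply_le_l2_opNorm _ i i).trans_eq ?_) (hd i)
  rw [CStarRing.norm_mul_mem_unitary _ U.2, CStarRing.norm_mem_unitary_mul _ (Unitary.star_mem U.2)]

end Matrix

/-- For a density matrix `ρ₀` and Hermitian `H_A, H_B, G, O`, with
`A(t₁,t₂) = i·Tr[exp(-i t₂ H_B) ρ₀ exp(i t₂ H_B) [G, exp(i t₁ H_A) O exp(-i t₁ H_A)]]`,
`K = max(‖H_B‖, ‖[H_A,O]‖)` and `Q = max(‖[G,O]‖, ‖G‖)`, every `t_A, t_B ≥ 0` satisfies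
`|A(t_A,t_B) − A(0,0)| ≤ 2·K·Q·(t_A + t_B)`. -/
theorem stmt_1 {n : ℕ} (ρ₀ H_A H_B G O : Matrix (Fin n) (Fin n) ℂ)
    (hρ : ρ₀.PosSemidef) (hρtr : ρ₀.trace = 1)
    (hHA : H_A.IsHermitian) (hHB : H_B.IsHermitian)
    (hG : G.IsHermitian) (hO : O.IsHermitian)
    (A : ℝ → ℝ → ℂ)
    (hA : ∀ t₁ t₂ : ℝ, A t₁ t₂ =
      Complex.I * (exp ((-Complex.I * (t₂ : ℂ)) • H_B) * ρ₀ *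
        exp ((Complex.I * (t₂ : ℂ)) • H_B) *
        (G * (exp ((Complex.I * (t₁ : ℂ)) • H_A) * O * exp ((-Complex.I * (t₁ : ℂ)) • H_A)) -
         (exp ((Complex.I * (t₁ : ℂ)) • H_A) * O * exp ((-Complex.I * (t₁ : ℂ)) • H_A)) * G)).trace)
    (K Q : ℝ)
    (hK : K = max ‖H_B‖ ‖H_A * O - O * H_A‖)
    (hQ : Q = max ‖G * O - O * G‖ ‖G‖) :
    ∀ t_A t_B : ℝ, 0 ≤ t_A → 0 ≤ t_B →
      ‖A t_A t_B - A 0 0‖ ≤ 2 * K * Q * (t_A + t_B) := by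
  intro t_A t_B htA htB
  set C := G * O - O * G with hC
  set V := exp ((Complex.I * (t_B : ℂ)) • H_B) with hV
  set V' := exp ((-Complex.I * (t_B : ℂ)) • H_B) with hV'
  set D := exp ((Complex.I * (t_A : ℂ)) • H_A) * O * exp ((-Complex.I * (t_A : ℂ)) • H_A) - O
    with hD
  have hsplit : A t_A t_B - A 0 0 =
      Complex.I * (ρ₀ * (V * (G * D - D * G) * V' + (V * C * V' - C))).trace := by
    have hcycle (X : Matrix (Fin n) (Fin n) ℂ) :
        (V' * ρ₀ * V * X).trace = (ρ₀ * (V * X * V')).trace := by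
      rw [mul_assoc, mul_assoc, trace_mul_comm]
      simp only [mul_assoc]
    rw [hA, hA, ← hV, ← hV', hcycle, ← mul_sub, ← trace_sub]
    simp only [Complex.ofReal_zero, mul_zero, zero_smul, exp_zero, one_mul, mul_one, hD, hC,
      ← mul_sub]
    congr 3
    noncomm_ring
  have hAterm : ‖V * (G * D - D * G) * V'‖ ≤ 2 * Q * (K * t_A) := by
    rw [CStarRing.norm_mul_mem_unitary _ (exp_neg_I_mul_ofReal_smul_mem_unitary hHB t_B),
      CStarRing.norm_mem_unitary_mul _ (exp_I_mul_ofReal_smul_mem_unitary hHB t_B)]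
    have hDle : ‖D‖ ≤ K * t_A := (norm_exp_conj_sub_le hHA O htA).trans <|
      mul_le_mul_of_nonneg_right (hK ▸ le_max_right _ _) htA
    have hGle : ‖G‖ ≤ Q := hQ ▸ le_max_right _ _
    have hKt : 0 ≤ K * t_A := (norm_nonneg _).trans hDle
    grw [norm_commutator_le, hDle, hGle]
  have hBterm : ‖V * C * V' - C‖ ≤ 2 * K * Q * t_B := by
    have hHle : ‖H_B‖ ≤ K := hK ▸ le_max_left _ _
    have hCle : ‖C‖ ≤ Q := hQ ▸ le_max_left _ _
    have hK₀ : 0 ≤ K := (norm_nonneg _).trans hHle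
    grw [norm_exp_conj_sub_le hHB C htB, norm_commutator_le, hHle, hCle]
  rw [hsplit, norm_mul, Complex.norm_I, one_mul]
  refine (hρ.norm_trace_mul_le _).trans ?_
  rw [hρtr, norm_one, one_mul]
  linarith [norm_add_le (V * (G * D - D * G) * V') (V * C * V' - C)]
end

section
/- Let ρ be an n×n density matrix and let H_A, G, O be Hermitian n×n complex matrices. Then for every t₁ ∈ ℝ, the function t ↦ i·Tr[ρ·[G, exp(i·t·H_A)·O·exp(-i·t·H_A)]] is differentiable at t₁, its derivative equals -Tr[ρ·[G, [H_A, exp(i·t₁·H_A)·O·exp(-i·t₁·H_A)]]], and the absolute value of this derivative is at most 2·‖G‖·‖[H_A, O]‖. -/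
open scoped Matrix.Norms.L2Operator ComplexOrder
open Matrix NormedSpace

/-- Every entry of a matrix is bounded by the `ℓ²` operator norm. -/
lemma Matrix.norm_entry_le_l2_opNorm {ι : Type*} [Fintype ι] [DecidableEq ι]
    (A : Matrix ι ι ℂ) (i j : ι) : ‖A i j‖ ≤ ‖A‖ := by
  have hmul := l2_opNorm_mulVec A (PiLp.single 2 j (1 : ℂ))
  have hentry := PiLp.norm_apply_le
    (WithLp.toLp 2 (A *ᵥ (PiLp.single 2 j (1 : ℂ)).ofLp)) i
  simp only [PiLp.ofLp_single, mulVec_single_one, col_apply,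
    PiLp.norm_single, norm_one, mul_one] at hmul hentry
  exact hentry.trans hmul

/-- Hölder's inequality for the trace pairing with a positive semidefinite matrix. -/
lemma Matrix.PosSemidef.norm_trace_mul_le_s3 {ι : Type*} [Fintype ι] [DecidableEq ι]
    {ρ : Matrix ι ι ℂ} (hρ : ρ.PosSemidef) (M : Matrix ι ι ℂ) :
    ‖(ρ * M).trace‖ ≤ ‖ρ.trace‖ * ‖M‖ := by
  set U := hρ.1.eigenvectorUnitary with hU
  set N : Matrix ι ι ℂ := star (U : Matrix ι ι ℂ) * M * (U : Matrix ι ι ℂ) with hN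
  have hnorm : ‖N‖ = ‖M‖ := by
    rw [hN, CStarRing.norm_mul_mem_unitary _ U.2,
      CStarRing.norm_mem_unitary_mul _ (Unitary.star_mem U.2)]
  have htrace : (ρ * M).trace = ∑ i, (hρ.1.eigenvalues i : ℂ) * N i i := by
    conv_lhs => rw [hρ.1.spectral_theorem]
    rw [Unitary.conjStarAlgAut_apply, mul_assoc, mul_assoc, trace_mul_comm, mul_assoc, ← hU, ← hN]
    simp [trace, diagonal_mul]
  have hsum : ‖ρ.trace‖ = ∑ i, hρ.1.eigenvalues i := by
    rw [hρ.1.trace_eq_sum_eigenvalues]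
    simp only [Complex.coe_algebraMap, ← Complex.ofReal_sum]
    exact Complex.norm_of_nonneg (Finset.sum_nonneg fun i _ => hρ.eigenvalues_nonneg i)
  rw [htrace, hsum, Finset.sum_mul]
  refine norm_sum_le_of_le _ fun i _ => ?_
  rw [norm_mul, Complex.norm_of_nonneg (hρ.eigenvalues_nonneg i), ← hnorm]
  exact mul_le_mul_of_nonneg_left (N.norm_entry_le_l2_opNorm i i) (hρ.eigenvalues_nonneg i)

/-- The propagator generated by a Hermitian matrix is unitary. -/
lemma Matrix.exp_I_mul_smul_mem_unitary {ι : Type*} [Fintype ι] [DecidableEq ι]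
    {H : Matrix ι ι ℂ} (hH : H.IsHermitian) (t : ℝ) :
    exp ((Complex.I * (t : ℂ)) • H) ∈ unitary (Matrix ι ι ℂ) := by
  have h : IsSelfAdjoint ((t : ℂ) • H) := IsSelfAdjoint.smul (Complex.conj_ofReal t) hH
  rw [mul_smul]
  exact (selfAdjoint.expUnitary ⟨(t : ℂ) • H, h⟩).2

/-- The norm of `[H, U O V]` is that of `[H, O]` when `U` and `V` are unitaries commuting with `H`. -/
lemma norm_commutator_conj_of_commute {A : Type*} [NormedRing A] [StarRing A] [CStarRing A]
    {H U V : A} (O : A) (hU : U ∈ unitary A) (hV : V ∈ unitary A)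
    (hHU : Commute H U) (hHV : Commute H V) :
    ‖H * (U * O * V) - U * O * V * H‖ = ‖H * O - O * H‖ := by
  have : H * (U * O * V) - U * O * V * H = U * (H * O - O * H) * V := by
    simp only [mul_sub, sub_mul, ← mul_assoc, hHU.eq]
    simp only [mul_assoc, hHV.eq]
  rw [this, CStarRing.norm_mul_mem_unitary _ hV, CStarRing.norm_mem_unitary_mul _ hU]

/-- Heisenberg's equation of motion. -/
lemma hasDerivAt_exp_conj {A : Type*} [NormedRing A] [NormedAlgebra ℂ A] [CompleteSpace A]
    (H O : A) (t₁ : ℝ) :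
    HasDerivAt
      (fun t : ℝ => exp ((Complex.I * (t : ℂ)) • H) * O * exp ((-Complex.I * (t : ℂ)) • H))
      (Complex.I •
        (H * (exp ((Complex.I * (t₁ : ℂ)) • H) * O * exp ((-Complex.I * (t₁ : ℂ)) • H)) -
          exp ((Complex.I * (t₁ : ℂ)) • H) * O * exp ((-Complex.I * (t₁ : ℂ)) • H) * H)) t₁ := by
  have hlin (c : ℂ) : HasDerivAt (fun t : ℝ => c * (t : ℂ)) c t₁ := by
    simpa using (Complex.ofRealCLM.hasDerivAt (x := t₁)).const_mul c
  have hleft := (hasDerivAt_exp_smul_const' (𝕂 := ℂ) H (Complex.I * t₁)).scomp t₁ (hlin Complex.I)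
  have hright := (hasDerivAt_exp_smul_const (𝕂 := ℂ) H (-Complex.I * t₁)).scomp t₁
    (hlin (-Complex.I))
  refine ((hleft.mul_const O).mul hright).congr_deriv ?_
  simp only [Function.comp_apply, smul_mul_assoc, mul_smul_comm, neg_smul, mul_assoc,
    mul_neg, sub_eq_add_neg, smul_add, smul_neg]

/-- For a density matrix `ρ` and Hermitian `H_A, G, O`, the function
`t ↦ i·Tr[ρ·[G, exp(i t H_A) O exp(-i t H_A)]]` is differentiable at every `t₁`, with derivative
`-Tr[ρ·[G, [H_A, exp(i t₁ H_A) O exp(-i t₁ H_A)]]]`, whose absolute value is at most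
`2·‖G‖·‖[H_A, O]‖`. -/
theorem stmt_3 {n : ℕ} (ρ H_A G O : Matrix (Fin n) (Fin n) ℂ)
    (hρ : ρ.PosSemidef) (hρtr : ρ.trace = 1)
    (hHA : H_A.IsHermitian) (hG : G.IsHermitian) (hO : O.IsHermitian) (t₁ : ℝ) :
    HasDerivAt
      (fun t : ℝ => Complex.I *
        (ρ * (G * (exp ((Complex.I * (t : ℂ)) • H_A) * O * exp ((-Complex.I * (t : ℂ)) • H_A)) -
          (exp ((Complex.I * (t : ℂ)) • H_A) * O * exp ((-Complex.I * (t : ℂ)) • H_A)) * G)).trace)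
      (-(ρ * (G * (H_A * (exp ((Complex.I * (t₁ : ℂ)) • H_A) * O * exp ((-Complex.I * (t₁ : ℂ)) • H_A)) -
              (exp ((Complex.I * (t₁ : ℂ)) • H_A) * O * exp ((-Complex.I * (t₁ : ℂ)) • H_A)) * H_A) -
            (H_A * (exp ((Complex.I * (t₁ : ℂ)) • H_A) * O * exp ((-Complex.I * (t₁ : ℂ)) • H_A)) -
              (exp ((Complex.I * (t₁ : ℂ)) • H_A) * O * exp ((-Complex.I * (t₁ : ℂ)) • H_A)) * H_A) * G)).trace)
      t₁ ∧
    norm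
      (-(ρ * (G * (H_A * (exp ((Complex.I * (t₁ : ℂ)) • H_A) * O * exp ((-Complex.I * (t₁ : ℂ)) • H_A)) -
              (exp ((Complex.I * (t₁ : ℂ)) • H_A) * O * exp ((-Complex.I * (t₁ : ℂ)) • H_A)) * H_A) -
            (H_A * (exp ((Complex.I * (t₁ : ℂ)) • H_A) * O * exp ((-Complex.I * (t₁ : ℂ)) • H_A)) -
              (exp ((Complex.I * (t₁ : ℂ)) • H_A) * O * exp ((-Complex.I * (t₁ : ℂ)) • H_A)) * H_A) * G)).trace)
      ≤ 2 * ‖G‖ * ‖H_A * O - O * H_A‖ := by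
  set X : ℝ → Matrix (Fin n) (Fin n) ℂ := fun t =>
    exp ((Complex.I * (t : ℂ)) • H_A) * O * exp ((-Complex.I * (t : ℂ)) • H_A)
  have hderiv := hasDerivAt_exp_conj H_A O t₁
  constructor
  · have htr := ((traceLinearMap (Fin n) ℝ ℂ).toContinuousLinearMap.hasFDerivAt.comp_hasDerivAt t₁
      (((hderiv.const_mul G).sub (hderiv.mul_const G)).const_mul ρ)).const_mul Complex.I
    refine htr.congr_deriv ?_
    simp only [LinearMap.coe_toContinuousLinearMap', traceLinearMap_apply, smul_mul_assoc,
      mul_smul_comm, ← smul_sub, trace_smul, smul_eq_mul, ← mul_assoc Complex.I,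
      Complex.I_mul_I, neg_one_mul]
  · set C := H_A * X t₁ - X t₁ * H_A
    have hV : exp ((-Complex.I * (t₁ : ℂ)) • H_A) ∈ unitary (Matrix (Fin n) (Fin n) ℂ) := by
      simpa using exp_I_mul_smul_mem_unitary hHA (-t₁)
    have hnorm : ‖C‖ = ‖H_A * O - O * H_A‖ :=
      norm_commutator_conj_of_commute O (exp_I_mul_smul_mem_unitary hHA t₁) hV
        ((Commute.refl H_A).smul_right _).exp_right ((Commute.refl H_A).smul_right _).exp_right
    calc ‖-(ρ * (G * C - C * G)).trace‖ ≤ ‖G * C - C * G‖ := by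
          simpa [hρtr] using hρ.norm_trace_mul_le_s3 (G * C - C * G)
      _ ≤ ‖G‖ * ‖C‖ + ‖C‖ * ‖G‖ :=
          (norm_sub_le _ _).trans (add_le_add (norm_mul_le _ _) (norm_mul_le _ _))
      _ = 2 * ‖G‖ * ‖H_A * O - O * H_A‖ := by rw [hnorm]; ring
end

section
/- For N qubits and a graph E on the qubit indices, let ϑ ∈ ℝ, φ ∈ ℝ^N, and define the hardware-efficient-ansatz block V = CZ_E · ∏_{j=1}^N exp(-i·φ_j·Z_j/2) · ∏_{j=1}^N exp(-i·ϑ·X_j/2). Then the commutator satisfies [X_1, V† · Y_1 · V] = 2·i·cos(φ_1) · (cos(ϑ)·Z_1 + sin(ϑ)·Y_1) · ∏_{j ∈ N(1)} (cos(ϑ)·Z_j + sin(ϑ)·Y_j), where N(1) is the set of neighbors of qubit 1 in E. -/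
open Matrix NormedSpace

namespace Qubits

noncomputable section

/-- N-qubit basis states. -/
abbrev QState (N : ℕ) := Fin N → Fin 2

/-- Operators on the N-qubit Hilbert space (dimension `2^N`). -/
abbrev QOp (N : ℕ) := Matrix (QState N) (QState N) ℂ

/-- Pauli X. -/
def pX : Matrix (Fin 2) (Fin 2) ℂ := !![0, 1; 1, 0]

/-- Pauli Y. -/
def pY : Matrix (Fin 2) (Fin 2) ℂ := !![0, -Complex.I; Complex.I, 0]

/-- Pauli Z. -/
def pZ : Matrix (Fin 2) (Fin 2) ℂ := !![1, 0; 0, -1]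

/-- The single-qubit operator `M` acting on qubit `k` and as the identity on all other qubits. -/
def onQubit {N : ℕ} (M : Matrix (Fin 2) (Fin 2) ℂ) (k : Fin N) : QOp N :=
  Matrix.of fun x y => if ∀ j, j ≠ k → x j = y j then M (x k) (y k) else 0

/-- The product `∏_{j ∈ S} f j` of matrices over a finite set of qubit indices, taken in
increasing order of the index (the factors we use always commute pairwise). -/
def prodOver {N : ℕ} (S : Finset (Fin N)) (f : Fin N → QOp N) : QOp N :=
  ((S.sort (· ≤ ·)).map f).prod

/-- The CZ layer of a graph `G` on the qubit indices: the diagonal matrix whose entry at the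
basis state `x` is `(-1)^(Σ_{{j,j'} ∈ E} x_j·x_{j'})`. -/
def czLayer {N : ℕ} (G : SimpleGraph (Fin N)) [DecidableRel G.Adj] : QOp N :=
  Matrix.diagonal fun x =>
    (-1 : ℂ) ^ ∑ e ∈ G.edgeFinset,
      Sym2.lift ⟨fun j j' => (x j : ℕ) * (x j' : ℕ), fun _ _ => Nat.mul_comm _ _⟩ e

end

end Qubits

namespace Qubits

/-- The tensor product of one single-qubit operator per qubit, as a monoid homomorphism. -/
noncomputable def tensorHom (N : ℕ) : (Fin N → Matrix (Fin 2) (Fin 2) ℂ) →* QOp N where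
  toFun M := Matrix.of fun x y => ∏ j, M j (x j) (y j)
  map_one' := by
    ext x y
    by_cases h : x = y
    · subst h; simp
    · obtain ⟨j, hj⟩ := Function.ne_iff.mp h
      rw [Matrix.one_apply_ne h]
      exact Finset.prod_eq_zero (Finset.mem_univ j) (Matrix.one_apply_ne hj)
  map_mul' A B := by
    ext x y
    simp only [Matrix.of_apply, Matrix.mul_apply, Pi.mul_apply, ← Finset.prod_mul_distrib]
    rw [Finset.prod_univ_sum, Fintype.piFinset_univ]

variable {N : ℕ}

theorem tensorHom_apply (M : Fin N → Matrix (Fin 2) (Fin 2) ℂ) (x y : QState N) :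
    tensorHom N M x y = ∏ j, M j (x j) (y j) := rfl

theorem tensorHom_conjTranspose (M : Fin N → Matrix (Fin 2) (Fin 2) ℂ) :
    (tensorHom N M)ᴴ = tensorHom N fun j => (M j)ᴴ := by
  ext x y
  simp [tensorHom_apply, Matrix.conjTranspose_apply]

theorem tensorHom_diagonal (d : Fin N → Fin 2 → ℂ) :
    tensorHom N (fun j => diagonal (d j)) = diagonal fun x => ∏ j, d j (x j) := by
  ext x y
  rw [tensorHom_apply]
  by_cases h : x = y
  · subst h; simp
  · obtain ⟨j, hj⟩ := Function.ne_iff.mp h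
    rw [Matrix.diagonal_apply_ne _ h]
    exact Finset.prod_eq_zero (Finset.mem_univ j) (Matrix.diagonal_apply_ne _ hj)

theorem onQubit_eq_tensorHom (M : Matrix (Fin 2) (Fin 2) ℂ) (k : Fin N) :
    onQubit M k = tensorHom N (Pi.mulSingle k M) := by
  ext x y
  rw [tensorHom_apply, onQubit, Matrix.of_apply]
  split_ifs with h
  · rw [Finset.prod_eq_single k]
    · simp
    · intro j _ hj
      simp [Pi.mulSingle_eq_of_ne hj, h j hj]
    · simp
  · push Not at h
    obtain ⟨j, hj, hxy⟩ := h
    refine (Finset.prod_eq_zero (Finset.mem_univ j) ?_).symm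
    rw [Pi.mulSingle_eq_of_ne hj, Matrix.one_apply_ne hxy]

theorem onQubit_add (A B : Matrix (Fin 2) (Fin 2) ℂ) (k : Fin N) :
    onQubit (A + B) k = onQubit A k + onQubit B k := by
  ext x y
  simp only [onQubit, Matrix.of_apply, Matrix.add_apply]
  split_ifs <;> simp

theorem onQubit_smul (c : ℂ) (A : Matrix (Fin 2) (Fin 2) ℂ) (k : Fin N) :
    onQubit (c • A) k = c • onQubit A k := by
  ext x y
  by_cases h : ∀ j, j ≠ k → x j = y j <;> simp [onQubit, h]

theorem onQubit_sub (A B : Matrix (Fin 2) (Fin 2) ℂ) (k : Fin N) :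
    onQubit (A - B) k = onQubit A k - onQubit B k := by
  ext x y
  simp only [onQubit, Matrix.of_apply, Matrix.sub_apply]
  split_ifs <;> simp

theorem onQubit_mul (A B : Matrix (Fin 2) (Fin 2) ℂ) (k : Fin N) :
    onQubit (A * B) k = onQubit A k * onQubit B k := by
  simp only [onQubit_eq_tensorHom, Pi.mulSingle_mul, map_mul]

theorem onQubit_one (k : Fin N) : onQubit 1 k = 1 := by
  rw [onQubit_eq_tensorHom, Pi.mulSingle_one, map_one]

theorem list_prod_mulSingle_apply {ι R : Type*} [DecidableEq ι] [Monoid R] (f : ι → R)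
    (l : List ι) (hl : l.Nodup) (i : ι) :
    (l.map fun j => Pi.mulSingle j (f j)).prod i = if i ∈ l then f i else 1 := by
  induction l with
  | nil => simp
  | cons a l ih =>
    obtain ⟨ha, hl⟩ := List.nodup_cons.mp hl
    rw [List.map_cons, List.prod_cons, Pi.mul_apply, ih hl]
    by_cases h : i = a
    · subst h; simp [ha]
    · simp [h]

theorem prodOver_onQubit (S : Finset (Fin N)) (M : Fin N → Matrix (Fin 2) (Fin 2) ℂ) :
    prodOver S (fun j => onQubit (M j) j) = tensorHom N fun j => if j ∈ S then M j else 1 := by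
  have h : (fun j => if j ∈ S then M j else 1) =
      ((S.sort (· ≤ ·)).map fun j => Pi.mulSingle j (M j)).prod := by
    funext i
    rw [list_prod_mulSingle_apply M _ (Finset.sort_nodup _ _)]
    simp
  rw [h, map_list_prod, List.map_map, prodOver]
  congr 2
  funext j
  exact onQubit_eq_tensorHom _ _

/-- The rotation `exp (-i t A / 2)` generated by an involution `A`, in closed form. -/
noncomputable def rotation {R : Type*} [Ring R] [Algebra ℂ R] (A : R) (t : ℝ) : R :=
  (Real.cos (t / 2) : ℂ) • (1 : R) + (-Complex.I * (Real.sin (t / 2) : ℂ)) • A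

theorem exp_smul_involution {n : Type*} [Fintype n] [DecidableEq n] {A : Matrix n n ℂ}
    (hA : A * A = 1) (c : ℂ) :
    exp (c • A) = Complex.cosh c • (1 : Matrix n n ℂ) + Complex.sinh c • A := by
  have hpow (m : ℕ) : (c • A) ^ m =
      c ^ m • ((1 / 2 : ℂ) • (1 + A)) + (-c) ^ m • ((1 / 2 : ℂ) • (1 - A)) := by
    induction m with
    | zero => simp only [pow_zero, one_smul]; module
    | succ m ih =>
      rw [pow_succ, ih]
      simp only [add_mul, sub_mul, smul_mul_assoc, mul_smul_comm, hA, one_mul, smul_sub, smul_add]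
      module
  have hs (z : ℂ) : HasSum (fun m : ℕ => (m.factorial : ℂ)⁻¹ * z ^ m) (Complex.exp z) := by
    rw [Complex.exp_eq_exp_ℂ]
    simpa using NormedSpace.exp_series_hasSum_exp' (𝕂 := ℂ) z
  have hsum := ((hs c).smul_const ((1 / 2 : ℂ) • (1 + A))).add
    ((hs (-c)).smul_const ((1 / 2 : ℂ) • (1 - A)))
  have hexp : exp (c • A) = Complex.exp c • ((1 / 2 : ℂ) • (1 + A)) +
      Complex.exp (-c) • ((1 / 2 : ℂ) • (1 - A)) := by
    rw [congrFun (NormedSpace.exp_eq_tsum ℂ) (c • A), ← hsum.tsum_eq]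
    simp only [hpow, smul_add, mul_smul]
  rw [hexp, Complex.cosh, Complex.sinh]
  module

theorem exp_onQubit {P : Matrix (Fin 2) (Fin 2) ℂ} (hP : P * P = 1) (t : ℝ) (k : Fin N) :
    exp ((-Complex.I * (t : ℂ) / 2) • onQubit P k) = onQubit (rotation P t) k := by
  have hc : -Complex.I * (t : ℂ) / 2 = -((t / 2 : ℝ) : ℂ) * Complex.I := by
    push_cast; ring
  rw [exp_smul_involution (by rw [← onQubit_mul, hP, onQubit_one]), hc, Complex.cosh_mul_I,
    Complex.sinh_mul_I, Complex.cos_neg, Complex.sin_neg, rotation, onQubit_add, onQubit_smul,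
    onQubit_smul, onQubit_one, Complex.ofReal_cos, Complex.ofReal_sin]
  congr 2
  ring

theorem pX_mul_self : pX * pX = 1 := by
  ext i j; fin_cases i <;> fin_cases j <;> simp [pX]

theorem pZ_mul_self : pZ * pZ = 1 := by
  ext i j; fin_cases i <;> fin_cases j <;> simp [pZ]

theorem pZ_eq_diagonal : pZ = diagonal fun b : Fin 2 => (-1 : ℂ) ^ (b : ℕ) := by
  ext i j; fin_cases i <;> fin_cases j <;> simp [pZ]

theorem cos_eq_half (t : ℝ) : Real.cos t = Real.cos (t / 2) ^ 2 - Real.sin (t / 2) ^ 2 := by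
  rw [← Real.cos_two_mul', mul_div_cancel₀ t two_ne_zero]

theorem sin_eq_half (t : ℝ) : Real.sin t = 2 * Real.sin (t / 2) * Real.cos (t / 2) := by
  rw [← Real.sin_two_mul, mul_div_cancel₀ t two_ne_zero]

theorem half_angle_sq (t : ℝ) :
    ((Real.cos (t / 2) : ℝ) : ℂ) ^ 2 + ((Real.sin (t / 2) : ℝ) : ℂ) ^ 2 = 1 := by
  exact_mod_cast Real.cos_sq_add_sin_sq (t / 2)

theorem rotation_pX_conjTranspose_mul_self (t : ℝ) : (rotation pX t)ᴴ * rotation pX t = 1 := by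
  have h := half_angle_sq t
  unfold rotation
  generalize Real.cos (t / 2) = a at *
  generalize Real.sin (t / 2) = b at *
  ext i j
  fin_cases i <;> fin_cases j <;>
    simp [pX, Matrix.mul_apply, Matrix.conjTranspose_apply] <;> grind [Complex.I_sq]

theorem rotation_pZ_conjTranspose_mul_self (t : ℝ) : (rotation pZ t)ᴴ * rotation pZ t = 1 := by
  have h := half_angle_sq t
  unfold rotation
  generalize Real.cos (t / 2) = a at *
  generalize Real.sin (t / 2) = b at *
  ext i j
  fin_cases i <;> fin_cases j <;>
    simp [pZ, Matrix.mul_apply, Matrix.conjTranspose_apply] <;> grind [Complex.I_sq]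

theorem rotation_pZ_conj_pZ (t : ℝ) : (rotation pZ t)ᴴ * pZ * rotation pZ t = pZ := by
  have hc : Commute pZ (rotation pZ t) :=
    ((Commute.one_right pZ).smul_right _).add_right ((Commute.refl pZ).smul_right _)
  rw [mul_assoc, hc.eq, ← mul_assoc, rotation_pZ_conjTranspose_mul_self, one_mul]

theorem rotation_pZ_conj_pY (t : ℝ) :
    (rotation pZ t)ᴴ * pY * rotation pZ t = (Real.cos t : ℂ) • pY + (Real.sin t : ℂ) • pX := by
  rw [cos_eq_half t, sin_eq_half t]
  unfold rotation
  generalize Real.cos (t / 2) = a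
  generalize Real.sin (t / 2) = b
  ext i j
  fin_cases i <;> fin_cases j <;>
    simp [pX, pY, pZ, Matrix.mul_apply, Matrix.conjTranspose_apply] <;> grind [Complex.I_sq]

theorem rotation_pX_conj_pZ (t : ℝ) :
    (rotation pX t)ᴴ * pZ * rotation pX t = (Real.cos t : ℂ) • pZ + (Real.sin t : ℂ) • pY := by
  rw [cos_eq_half t, sin_eq_half t]
  unfold rotation
  generalize Real.cos (t / 2) = a
  generalize Real.sin (t / 2) = b
  ext i j
  fin_cases i <;> fin_cases j <;>
    simp [pX, pY, pZ, Matrix.mul_apply, Matrix.conjTranspose_apply] <;> grind [Complex.I_sq]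

theorem rotation_pX_conj_pY (t : ℝ) :
    (rotation pX t)ᴴ * pY * rotation pX t = (Real.cos t : ℂ) • pY - (Real.sin t : ℂ) • pZ := by
  rw [cos_eq_half t, sin_eq_half t]
  unfold rotation
  generalize Real.cos (t / 2) = a
  generalize Real.sin (t / 2) = b
  ext i j
  fin_cases i <;> fin_cases j <;>
    simp [pX, pY, pZ, Matrix.mul_apply, Matrix.conjTranspose_apply] <;> grind [Complex.I_sq]

theorem rotation_pX_conj_pX (t : ℝ) : (rotation pX t)ᴴ * pX * rotation pX t = pX := by
  have hc : Commute pX (rotation pX t) :=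
    ((Commute.one_right pX).smul_right _).add_right ((Commute.refl pX).smul_right _)
  rw [mul_assoc, hc.eq, ← mul_assoc, rotation_pX_conjTranspose_mul_self, one_mul]

theorem prodOver_pZ (S : Finset (Fin N)) :
    prodOver S (onQubit pZ) = diagonal fun x => ∏ j ∈ S, (-1 : ℂ) ^ (x j : ℕ) := by
  have h : (fun j => if j ∈ S then pZ else 1) =
      fun j => diagonal fun b : Fin 2 => if j ∈ S then (-1 : ℂ) ^ (b : ℕ) else 1 := by
    funext j
    split_ifs <;> simp [pZ_eq_diagonal]
  rw [show onQubit pZ = fun j : Fin N => onQubit pZ j from rfl,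
    prodOver_onQubit S fun _ => pZ, h, tensorHom_diagonal]
  simp [Finset.prod_ite_mem]

/-- The exponent `x_j x_{j'}` contributed by an edge to the CZ layer. -/
def edgeExponent (x : QState N) : Sym2 (Fin N) → ℕ :=
  Sym2.lift ⟨fun j j' => (x j : ℕ) * (x j' : ℕ), fun _ _ => Nat.mul_comm _ _⟩

theorem edgeExponent_mk (x : QState N) (i j : Fin N) :
    edgeExponent x s(i, j) = (x i : ℕ) * (x j : ℕ) := rfl

theorem czLayer_eq (G : SimpleGraph (Fin N)) [DecidableRel G.Adj] :
    czLayer G = diagonal fun x => ∏ e ∈ G.edgeFinset, (-1 : ℂ) ^ edgeExponent x e := by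
  simp only [Finset.prod_pow_eq_pow_sum]
  rfl

theorem edgeSign_mul_flip (G : SimpleGraph (Fin N)) [DecidableRel G.Adj] (k : Fin N)
    {x y : QState N} (hne : x k ≠ y k) (h : ∀ j, j ≠ k → x j = y j) :
    (∏ e ∈ G.edgeFinset, (-1 : ℂ) ^ edgeExponent x e) *
      (∏ e ∈ G.edgeFinset, (-1 : ℂ) ^ edgeExponent y e) =
      ∏ j ∈ G.neighborFinset k, (-1 : ℂ) ^ (y j : ℕ) := by
  have hinc : (G.neighborFinset k).image (fun j => s(k, j)) ⊆ G.edgeFinset := by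
    intro e he
    obtain ⟨j, hj, rfl⟩ := Finset.mem_image.mp he
    simpa using hj
  rw [← Finset.prod_mul_distrib, ← Finset.prod_subset hinc, Finset.prod_image]
  · refine Finset.prod_congr rfl fun j hj => ?_
    have hjk : j ≠ k := by
      rintro rfl
      simp at hj
    rw [edgeExponent_mk, edgeExponent_mk, h j hjk, ← pow_add, ← add_mul]
    have hone : (x k : ℕ) + (y k : ℕ) = 1 := by lia
    rw [hone, one_mul]
  · intro i _ j _ hij
    exact Sym2.congr_right.mp hij
  · intro e he hnot
    induction e with
    | _ i j =>
      have hadj : G.Adj i j := by simpa using he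
      have hi : i ≠ k := by
        rintro rfl
        exact hnot (Finset.mem_image.mpr ⟨j, by simpa using hadj, rfl⟩)
      have hj : j ≠ k := by
        rintro rfl
        exact hnot (Finset.mem_image.mpr ⟨i, by simpa using hadj.symm, Sym2.eq_swap⟩)
      rw [edgeExponent_mk, edgeExponent_mk, h i hi, h j hj, ← pow_add, ← two_mul, pow_mul]
      simp

theorem czLayer_conj_pY (G : SimpleGraph (Fin N)) [DecidableRel G.Adj] (k : Fin N) :
    (czLayer G)ᴴ * onQubit pY k * czLayer G =
      onQubit pY k * prodOver (G.neighborFinset k) (onQubit pZ) := by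
  have hstar : (czLayer G)ᴴ = czLayer G := by
    rw [czLayer, Matrix.diagonal_conjTranspose]
    congr 1
    funext x
    simp
  rw [hstar, czLayer_eq, prodOver_pZ]
  ext x y
  rw [Matrix.mul_diagonal, Matrix.diagonal_mul, Matrix.mul_diagonal]
  by_cases h : ∀ j, j ≠ k → x j = y j
  · by_cases hk : x k = y k
    · have hzero : onQubit pY k x y = 0 := by
        have hdiag (b : Fin 2) : pY b b = 0 := by fin_cases b <;> simp [pY]
        simp [onQubit, hk, hdiag]
      simp [hzero]
    · rw [← edgeSign_mul_flip G k hk h]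
      ring
  · simp [onQubit, h]

theorem onQubit_commute_prodOver {S : Finset (Fin N)} {k : Fin N} (hk : k ∉ S)
    (A : Matrix (Fin 2) (Fin 2) ℂ) (M : Fin N → Matrix (Fin 2) (Fin 2) ℂ) :
    Commute (onQubit A k) (prodOver S fun j => onQubit (M j) j) := by
  rw [onQubit_eq_tensorHom, prodOver_onQubit]
  refine Commute.map (Pi.commute_iff.mpr fun j => ?_) _
  by_cases hj : j = k
  · subst hj; simp [hk]
  · simp [Pi.mulSingle_eq_of_ne hj]

/-- Conjugation of `Y_k` by the block consisting of an `X` layer, a `Z` layer and a CZ layer. -/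
theorem conj_block (G : SimpleGraph (Fin N)) [DecidableRel G.Adj] (ϑ : ℝ) (φ : Fin N → ℝ)
    (k : Fin N) :
    (czLayer G *
        prodOver Finset.univ (fun j => exp ((-Complex.I * (φ j : ℂ) / 2) • onQubit pZ j)) *
        prodOver Finset.univ (fun j => exp ((-Complex.I * (ϑ : ℂ) / 2) • onQubit pX j)))ᴴ *
      onQubit pY k *
      (czLayer G *
        prodOver Finset.univ (fun j => exp ((-Complex.I * (φ j : ℂ) / 2) • onQubit pZ j)) *
        prodOver Finset.univ (fun j => exp ((-Complex.I * (ϑ : ℂ) / 2) • onQubit pX j))) =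
      onQubit ((Real.cos (φ k) : ℂ) • ((Real.cos ϑ : ℂ) • pY - (Real.sin ϑ : ℂ) • pZ) +
          (Real.sin (φ k) : ℂ) • pX) k *
        prodOver (G.neighborFinset k)
          (fun j => onQubit ((Real.cos ϑ : ℂ) • pZ + (Real.sin ϑ : ℂ) • pY) j) := by
  have hk : k ∉ G.neighborFinset k := by simp
  simp only [exp_onQubit pZ_mul_self, exp_onQubit pX_mul_self]
  rw [prodOver_onQubit _ fun j => rotation pZ (φ j), prodOver_onQubit _ fun _ => rotation pX ϑ]
  simp only [Finset.mem_univ, if_true, Matrix.conjTranspose_mul, tensorHom_conjTranspose]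
  set Rz := tensorHom N fun j => rotation pZ (φ j)
  set Rx := tensorHom N fun _ => rotation pX ϑ
  set Rz' := tensorHom N fun j => (rotation pZ (φ j))ᴴ
  set Rx' := tensorHom N fun _ => (rotation pX ϑ)ᴴ
  have hassoc : Rx' * (Rz' * (czLayer G)ᴴ) * onQubit pY k * (czLayer G * Rz * Rx) =
      Rx' * Rz' * ((czLayer G)ᴴ * onQubit pY k * czLayer G) * Rz * Rx := by
    simp only [mul_assoc]
  rw [hassoc, czLayer_conj_pY, show onQubit pZ = fun j : Fin N => onQubit pZ j from rfl,
    prodOver_onQubit _ fun _ => pZ, prodOver_onQubit, onQubit_eq_tensorHom, onQubit_eq_tensorHom,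
    ← map_mul, ← map_mul, ← map_mul, ← map_mul, ← map_mul, ← map_mul]
  congr 1
  funext j
  have hgroup (A B C D E : Matrix (Fin 2) (Fin 2) ℂ) :
      A * B * C * D * E = A * (B * C * D) * E := by
    simp only [mul_assoc]
  simp only [Pi.mul_apply]
  rw [hgroup]
  by_cases hj : j = k
  · subst hj
    simp only [Pi.mulSingle_eq_same, hk, if_false, mul_one]
    rw [rotation_pZ_conj_pY, mul_add, add_mul, mul_smul_comm, mul_smul_comm, smul_mul_assoc,
      smul_mul_assoc, rotation_pX_conj_pY, rotation_pX_conj_pX]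
  · simp only [Pi.mulSingle_eq_of_ne hj, one_mul]
    split_ifs
    · rw [rotation_pZ_conj_pZ, rotation_pX_conj_pZ]
    · rw [mul_one, rotation_pZ_conjTranspose_mul_self, mul_one,
        rotation_pX_conjTranspose_mul_self]

theorem pX_commutator (a b c s : ℂ) :
    pX * (c • (a • pY - b • pZ) + s • pX) - (c • (a • pY - b • pZ) + s • pX) * pX =
      (2 * Complex.I * c) • (a • pZ + b • pY) := by
  ext i j
  fin_cases i <;> fin_cases j <;>
    simp [pX, pY, pZ] <;> grind [Complex.I_sq]

end Qubits

open Matrix Qubits NormedSpace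

/-- For the HEA block
V = CZ_E · ∏_j exp(-i·φ_j·Z_j/2) · ∏_j exp(-i·ϑ·X_j/2), the commutator satisfies
[X₁, V† · Y₁ · V] = 2·i·cos(φ₁)·(cos(ϑ)·Z₁ + sin(ϑ)·Y₁) ·
∏_{j ∈ N(1)} (cos(ϑ)·Z_j + sin(ϑ)·Y_j), where qubit 1 is the first qubit. -/
theorem stmt_15 {N : ℕ} (hN : 0 < N) (G : SimpleGraph (Fin N)) [DecidableRel G.Adj]
    (ϑ : ℝ) (φ : Fin N → ℝ)
    (V : QOp N)
    (hV : V = czLayer G *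
      prodOver Finset.univ (fun j => exp ((-Complex.I * (φ j : ℂ) / 2) • onQubit pZ j)) *
      prodOver Finset.univ (fun j => exp ((-Complex.I * (ϑ : ℂ) / 2) • onQubit pX j))) :
    onQubit pX ⟨0, hN⟩ * (Vᴴ * onQubit pY ⟨0, hN⟩ * V) -
        (Vᴴ * onQubit pY ⟨0, hN⟩ * V) * onQubit pX ⟨0, hN⟩ =
      ((2 * Complex.I * (Real.cos (φ ⟨0, hN⟩) : ℂ)) •
        ((Real.cos ϑ : ℂ) • onQubit pZ ⟨0, hN⟩ + (Real.sin ϑ : ℂ) • onQubit pY ⟨0, hN⟩)) *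
      prodOver (G.neighborFinset ⟨0, hN⟩)
        (fun j => (Real.cos ϑ : ℂ) • onQubit pZ j + (Real.sin ϑ : ℂ) • onQubit pY j) := by
  set k : Fin N := ⟨0, hN⟩
  set T : Matrix (Fin 2) (Fin 2) ℂ := (Real.cos ϑ : ℂ) • pZ + (Real.sin ϑ : ℂ) • pY with hT
  have hprod : (fun j : Fin N => (Real.cos ϑ : ℂ) • onQubit pZ j + (Real.sin ϑ : ℂ) • onQubit pY j)
      = fun j => onQubit T j := by
    simp only [hT, onQubit_add, onQubit_smul]
  have hk : k ∉ G.neighborFinset k := by simp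
  rw [hV, conj_block, hprod, ← onQubit_smul, ← onQubit_smul, ← onQubit_add, ← hT,
    ← onQubit_smul, ← mul_assoc, mul_assoc (onQubit _ k) _ (onQubit pX k),
    ← (onQubit_commute_prodOver hk pX fun _ => T).eq, ← mul_assoc, ← sub_mul, ← onQubit_mul,
    ← onQubit_mul, ← onQubit_sub, pX_commutator]
end
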